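/- Suppose f_0 : A → ℝ satisfies ⟨f_0,h⟩ = Σ_{(i,j)∈A} f_0(i,j)h(i,j) = 0 for every h : A → ℝ with zero line sums with respect to S. Put D = Σ_{(i,j)∈A} f_0(i,j) and E = Σ_{(i,j)∈A} min(f_0(i,j)², (1 − f_0(i,j))²). Let t be a natural number such that every subset B ⊆ A with exactly t+1 elements satisfies Σ_{(i,j)∈B} |2 f_0(i,j) − 1| > 2(D − E − Σ_{(i,j)∈A} f_0(i,j)²). Then any two functions g_1, g_2 : A → {0,1} having the same line sums as f_0 with respect to S satisfy g_1(i,j) = g_2(i,j) for at least mn − t pairs (i,j) ∈ A. -/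

import Mathlib

open scoped Classical

/-- `(a,b)` is a direction: coprime entries and `a ≥ 0`. -/
def IsDirection (d : ℤ × ℤ) : Prop := Int.gcd d.1 d.2 = 1 ∧ 0 ≤ d.1

/-- The line sum of `f : A → ℝ` along the line `a·j = b·i + t` for the direction
`d = (a,b)`, where `A = {0,…,m−1} × {0,…,n−1}`. -/
noncomputable def lineSum (m n : ℕ) (f : Fin m × Fin n → ℝ) (d : ℤ × ℤ) (t : ℤ) : ℝ :=
  ∑ p ∈ Finset.univ.filter
      (fun p : Fin m × Fin n => d.1 * (p.2 : ℤ) = d.2 * (p.1 : ℤ) + t), f p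

theorem lineSum_sub (m n : ℕ) (f g : Fin m × Fin n → ℝ) (d : ℤ × ℤ) (t : ℤ) :
    lineSum m n (fun p => g p - f p) d t = lineSum m n g d t - lineSum m n f d t := by
  simp [lineSum, Finset.sum_sub_distrib]

/-- The line sums in a single direction determine the total sum. -/
theorem sum_eq_sum_lineSum (m n : ℕ) (f : Fin m × Fin n → ℝ) (d : ℤ × ℤ) :
    ∑ p, f p = ∑ t ∈ Finset.univ.image
      (fun p : Fin m × Fin n => d.1 * (p.2 : ℤ) - d.2 * (p.1 : ℤ)), lineSum m n f d t := by
  rw [← Finset.sum_fiberwise_of_maps_to (fun p hp => Finset.mem_image_of_mem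
    (fun p : Fin m × Fin n => d.1 * (p.2 : ℤ) - d.2 * (p.1 : ℤ)) hp) f]
  refine Finset.sum_congr rfl fun t _ => Finset.sum_congr ?_ fun _ _ => rfl
  ext p
  simp only [Finset.mem_filter, Finset.mem_univ, true_and]
  rw [sub_eq_iff_eq_add']

/-- The squared distance from `f₀` to a binary function with the same line sums. -/
theorem sum_sq_sub_of_lineSum_eq {m n : ℕ} {S : Finset (ℤ × ℤ)} (hS : S.Nonempty)
    {f0 : Fin m × Fin n → ℝ}
    (horth : ∀ h : Fin m × Fin n → ℝ,
      (∀ d ∈ S, ∀ t : ℤ, lineSum m n h d t = 0) → ∑ p, f0 p * h p = 0)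
    {g : Fin m × Fin n → ℝ} (hg : ∀ p, g p = 0 ∨ g p = 1)
    (hgf : ∀ d ∈ S, ∀ r : ℤ, lineSum m n g d r = lineSum m n f0 d r) :
    ∑ p, (g p - f0 p) ^ 2 = ∑ p, f0 p - ∑ p, f0 p ^ 2 := by
  obtain ⟨d, hd⟩ := hS
  have hsum : ∑ p, g p = ∑ p, f0 p := by
    rw [sum_eq_sum_lineSum m n g d, sum_eq_sum_lineSum m n f0 d]
    exact Finset.sum_congr rfl fun t _ => hgf d hd t
  have hinner := horth (fun p => g p - f0 p) fun d hd t => by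
    rw [lineSum_sub, hgf d hd t, sub_self]
  have hexp : ∀ p, (g p - f0 p) ^ 2 = g p - f0 p ^ 2 - 2 * (f0 p * (g p - f0 p)) := fun p => by
    rcases hg p with h | h <;> rw [h] <;> ring
  rw [Finset.sum_congr rfl fun p _ => hexp p, Finset.sum_sub_distrib, Finset.sum_sub_distrib,
    ← Finset.mul_sum, hinner, hsum]
  ring

theorem min_sq_le_of_binary {x y : ℝ} (hy : y = 0 ∨ y = 1) :
    min (x ^ 2) ((1 - x) ^ 2) ≤ (y - x) ^ 2 := by
  rcases hy with rfl | rfl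
  · exact (min_le_left _ _).trans_eq (by ring)
  · exact min_le_right _ _

theorem sq_add_one_sub_sq_eq (x : ℝ) :
    x ^ 2 + (1 - x) ^ 2 = 2 * min (x ^ 2) ((1 - x) ^ 2) + |2 * x - 1| := by
  rcases le_total (2 * x - 1) 0 with h | h
  · rw [abs_of_nonpos h, min_eq_left (by nlinarith)]
    ring
  · rw [abs_of_nonneg h, min_eq_right (by nlinarith)]
    ring

theorem abs_two_mul_sub_one_eq_of_ne {x y z : ℝ} (hy : y = 0 ∨ y = 1) (hz : z = 0 ∨ z = 1)
    (hyz : y ≠ z) :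
    |2 * x - 1| = (y - x) ^ 2 + (z - x) ^ 2 - 2 * min (x ^ 2) ((1 - x) ^ 2) := by
  have hx := sq_add_one_sub_sq_eq x
  rcases hy with rfl | rfl <;> rcases hz with rfl | rfl <;>
    first | exact absurd rfl hyz | linarith

/-- Theorem 4.3 (b): any two binary solutions `g₁, g₂` agree on at least `mn − t`
pixels. -/
theorem stmt_8 (m n : ℕ) (hm : 0 < m) (hn : 0 < n)
    (S : Finset (ℤ × ℤ)) (hS : S.Nonempty) (hSdir : ∀ d ∈ S, IsDirection d)
    (f0 : Fin m × Fin n → ℝ)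
    (horth : ∀ h : Fin m × Fin n → ℝ,
      (∀ d ∈ S, ∀ t : ℤ, lineSum m n h d t = 0) →
      ∑ p : Fin m × Fin n, f0 p * h p = 0)
    (D E : ℝ)
    (hD : D = ∑ p : Fin m × Fin n, f0 p)
    (hE : E = ∑ p : Fin m × Fin n, min ((f0 p) ^ 2) ((1 - f0 p) ^ 2))
    (t : ℕ)
    (ht : ∀ B : Finset (Fin m × Fin n), B.card = t + 1 →
      ∑ p ∈ B, |2 * f0 p - 1| >
        2 * (D - E - ∑ p : Fin m × Fin n, (f0 p) ^ 2)) :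
    ∀ g₁ g₂ : Fin m × Fin n → ℝ,
      (∀ p, g₁ p = 0 ∨ g₁ p = 1) → (∀ p, g₂ p = 0 ∨ g₂ p = 1) →
      (∀ d ∈ S, ∀ r : ℤ, lineSum m n g₁ d r = lineSum m n f0 d r) →
      (∀ d ∈ S, ∀ r : ℤ, lineSum m n g₂ d r = lineSum m n f0 d r) →
      m * n - t ≤ (Finset.univ.filter (fun p : Fin m × Fin n => g₁ p = g₂ p)).card := by
  intro g₁ g₂ hg₁ hg₂ h₁ h₂
  by_contra! hlt
  have hcard := Finset.card_filter_add_card_filter_not (s := Finset.univ)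
    (fun p : Fin m × Fin n => g₁ p = g₂ p)
  rw [Finset.card_univ, Fintype.card_prod, Fintype.card_fin, Fintype.card_fin] at hcard
  obtain ⟨B, hBsub, hB⟩ := Finset.exists_subset_card_eq
    (s := Finset.univ.filter fun p : Fin m × Fin n => ¬ g₁ p = g₂ p) (n := t + 1) (by omega)
  have hBle : ∑ p ∈ B, |2 * f0 p - 1| ≤ ∑ p, ((g₁ p - f0 p) ^ 2 + (g₂ p - f0 p) ^ 2
      - 2 * min (f0 p ^ 2) ((1 - f0 p) ^ 2)) := by
    rw [Finset.sum_congr rfl fun p hp => abs_two_mul_sub_one_eq_of_ne (x := f0 p) (hg₁ p) (hg₂ p)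
      (Finset.mem_filter.1 (hBsub hp)).2]
    refine Finset.sum_le_sum_of_subset_of_nonneg (Finset.subset_univ B) fun p _ _ => ?_
    linarith [min_sq_le_of_binary (x := f0 p) (hg₁ p), min_sq_le_of_binary (x := f0 p) (hg₂ p)]
  rw [Finset.sum_sub_distrib, Finset.sum_add_distrib, ← Finset.mul_sum, ← hE,
    sum_sq_sub_of_lineSum_eq hS horth hg₁ h₁, sum_sq_sub_of_lineSum_eq hS horth hg₂ h₂, ← hD]
    at hBle
  linarith [ht B hB]
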